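/- Let λ > 0, C ≥ 0, A ≥ 0. Let y, w : [0,∞) → [0,∞) be continuous and z : [0,∞) → [0,∞) differentiable, and suppose for all t ≥ 0: z'(t) ≤ −(1/2)·w(t) + C·(y(t) + z(t)), and ∫_t^∞ (y(s) + z(s)) ds ≤ A·e^{−λ·t/2}. Then for all t ≥ 1/2: z(t) ≤ (2 + C)·e^{λ/4}·A·e^{−λ·t/2}, and ∫_t^∞ w(s) ds ≤ 2·((2 + C)·e^{λ/4} + C)·A·e^{−λ·t/2}. -/

import Mathlib

open Set Real MeasureTheory

/-- A nonnegative function that is continuous on `[t, ∞)` and whose integrals over `[t, b]` are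
bounded by `M` is integrable on `[t, ∞)`, with integral at most `M`. -/
theorem integrableOn_Ici_and_integral_le_of_intervalIntegral_le {w : ℝ → ℝ} {t M : ℝ}
    (hw : ContinuousOn w (Ici t)) (hw0 : ∀ s, t ≤ s → 0 ≤ w s)
    (hM : ∀ b, t ≤ b → (∫ s in t..b, w s) ≤ M) :
    IntegrableOn w (Ici t) ∧ (∫ s in Ici t, w s) ≤ M := by
  have hint : IntegrableOn w (Ioi t) := by
    refine integrableOn_Ioi_of_intervalIntegral_norm_bounded (l := Filter.atTop) (b := id) M t
      (fun b => ?_) Filter.tendsto_id ?_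
    · exact ((hw.mono Icc_subset_Ici_self).integrableOn_Icc).mono_set Ioc_subset_Icc_self
    · filter_upwards [Filter.eventually_ge_atTop t] with b hb
      refine le_of_eq_of_le (intervalIntegral.integral_congr fun s hs => ?_) (hM b hb)
      rw [id, uIcc_of_le hb] at hs
      exact norm_of_nonneg (hw0 s hs.1)
  refine ⟨(integrableOn_Ici_iff_integrableOn_Ioi (by simp)).2 hint, ?_⟩
  rw [integral_Ici_eq_integral_Ioi]
  refine le_of_tendsto (intervalIntegral_tendsto_integral_Ioi t hint Filter.tendsto_id) ?_
  filter_upwards [Filter.eventually_ge_atTop t] with b hb using hM b hb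

/-- The integral over `[a, b]` of a function nonnegative on `[a, ∞)` is at most its tail
integral. -/
theorem intervalIntegral_le_integral_Ici {f : ℝ → ℝ} {a b : ℝ} (hab : a ≤ b)
    (hf : IntegrableOn f (Ici a)) (hf0 : ∀ s, a ≤ s → 0 ≤ f s) :
    (∫ s in a..b, f s) ≤ ∫ s in Ici a, f s := by
  rw [intervalIntegral.integral_of_le hab]
  refine setIntegral_mono_set hf ?_ (Ioc_subset_Icc_self.trans Icc_subset_Ici_self).eventuallyLE
  filter_upwards [ae_restrict_mem measurableSet_Ici] with s hs using hf0 s hs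

/-- Cut-off argument: if `z' ≤ C * f` and `z ≤ f` on `[a, a + 1 / 2]`, then `z (a + 1 / 2)` is
controlled by the integral of `f`. -/
theorem le_mul_intervalIntegral_of_deriv_le {f z z' : ℝ → ℝ} {a C : ℝ} (hC : 0 ≤ C)
    (hderiv : ∀ s ∈ Ici a, HasDerivWithinAt z (z' s) (Ici a) s)
    (hf : IntegrableOn f (Icc a (a + 1 / 2))) (hf0 : ∀ s, a ≤ s → 0 ≤ f s)
    (hzf : ∀ s, a ≤ s → z s ≤ f s) (hz' : ∀ s, a ≤ s → z' s ≤ C * f s) :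
    z (a + 1 / 2) ≤ (2 + C) * ∫ s in a..(a + 1 / 2), f s := by
  have hg : ∀ s ∈ Ici a, HasDerivWithinAt (fun s => 2 * (s - a) * z s)
      (2 * z s + 2 * (s - a) * z' s) (Ici a) s := fun s hs => by
    have h : HasDerivWithinAt (fun s : ℝ => 2 * (s - a)) 2 (Ici a) s := by
      simpa using (((hasDerivAt_id s).sub_const a).const_mul 2).hasDerivWithinAt
    exact h.mul (hderiv s hs)
  have key := intervalIntegral.sub_le_integral_of_hasDeriv_right_of_le
    (g := fun s => 2 * (s - a) * z s) (φ := fun s => (2 + C) * f s)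
    (by linarith : a ≤ a + 1 / 2)
    (fun s hs => (hg s hs.1).continuousWithinAt.mono Icc_subset_Ici_self)
    (fun s hs => (hg s hs.1.le).mono (Ioi_subset_Ici hs.1.le))
    (hf.const_mul (2 + C))
    (fun s hs => by
      have has := hs.1.le
      have h₁ : 2 * (s - a) * z' s ≤ 2 * (s - a) * (C * f s) :=
        mul_le_mul_of_nonneg_left (hz' s has) (by linarith)
      have h₂ : 2 * (s - a) * (C * f s) ≤ 1 * (C * f s) :=
        mul_le_mul_of_nonneg_right (by linarith [hs.2]) (mul_nonneg hC (hf0 s has))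
      linarith [hzf s has])
  rw [intervalIntegral.integral_const_mul] at key
  simpa using key

/-- The inductive engine of the exponential-decay bootstrap in the proof of Theorem 5.1. -/
theorem stmt_7 (lam C A : ℝ) (hlam : 0 < lam) (hC : 0 ≤ C) (hA : 0 ≤ A)
    (y z z' w : ℝ → ℝ)
    (hy_nonneg : ∀ t, 0 ≤ t → 0 ≤ y t)
    (hz_nonneg : ∀ t, 0 ≤ t → 0 ≤ z t)
    (hw_nonneg : ∀ t, 0 ≤ t → 0 ≤ w t)
    (hy_cont : ContinuousOn y (Ici (0:ℝ)))
    (hw_cont : ContinuousOn w (Ici (0:ℝ)))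
    (hderiv : ∀ t ∈ Ici (0:ℝ), HasDerivWithinAt z (z' t) (Ici (0:ℝ)) t)
    (hineq : ∀ t, 0 ≤ t → z' t ≤ -(1 / 2) * w t + C * (y t + z t))
    (hInt : ∀ t, 0 ≤ t → IntegrableOn (fun s => y s + z s) (Ici t))
    (htail : ∀ t, 0 ≤ t → (∫ s in Ici t, (y s + z s)) ≤ A * Real.exp (-lam * t / 2)) :
    ∀ t, 1 / 2 ≤ t →
      z t ≤ (2 + C) * Real.exp (lam / 4) * A * Real.exp (-lam * t / 2) ∧
      IntegrableOn w (Ici t) ∧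
      (∫ s in Ici t, w s) ≤
        2 * ((2 + C) * Real.exp (lam / 4) + C) * A * Real.exp (-lam * t / 2) := by
  intro t ht
  have hf0 : ∀ s, 0 ≤ s → 0 ≤ y s + z s := fun s hs => add_nonneg (hy_nonneg s hs) (hz_nonneg s hs)
  have hz : z t ≤ (2 + C) * Real.exp (lam / 4) * A * Real.exp (-lam * t / 2) := by
    have ha : 0 ≤ t - 1 / 2 := by linarith
    have hcut := le_mul_intervalIntegral_of_deriv_le (f := fun s => y s + z s) (a := t - 1 / 2) hC
      (fun s hs => (hderiv s (ha.trans hs)).mono (Ici_subset_Ici.2 ha))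
      ((hInt _ ha).mono_set Icc_subset_Ici_self) (fun s hs => hf0 s (ha.trans hs))
      (fun s hs => by linarith [hy_nonneg s (ha.trans hs)])
      (fun s hs => by linarith [hineq s (ha.trans hs), hw_nonneg s (ha.trans hs)])
    rw [sub_add_cancel] at hcut
    have hle := (intervalIntegral_le_integral_Ici (by linarith : t - 1 / 2 ≤ t) (hInt _ ha)
      (fun s hs => hf0 s (ha.trans hs))).trans (htail _ ha)
    have hexp : Real.exp (-lam * (t - 1 / 2) / 2) =
        Real.exp (lam / 4) * Real.exp (-lam * t / 2) := by
      rw [← Real.exp_add]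
      ring_nf
    rw [hexp] at hle
    calc z t ≤ _ := hcut
      _ ≤ (2 + C) * (A * (Real.exp (lam / 4) * Real.exp (-lam * t / 2))) := by gcongr
      _ = _ := by ring
  have ht0 : 0 ≤ t := by linarith
  have hw_cont' : ContinuousOn w (Ici t) := hw_cont.mono (Ici_subset_Ici.2 ht0)
  refine ⟨hz, integrableOn_Ici_and_integral_le_of_intervalIntegral_le hw_cont'
    (fun s hs => hw_nonneg s (ht0.trans hs)) fun b hb => ?_⟩
  have hwint : IntegrableOn w (Icc t b) := (hw_cont'.mono Icc_subset_Ici_self).integrableOn_Icc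
  have hfint : IntegrableOn (fun s => y s + z s) (Icc t b) :=
    (hInt t ht0).mono_set Icc_subset_Ici_self
  have key := intervalIntegral.sub_le_integral_of_hasDeriv_right_of_le
    (φ := fun s => -(1 / 2) * w s + C * (y s + z s)) hb
    (fun s hs => (hderiv s (ht0.trans hs.1)).continuousWithinAt.mono
      fun x hx => ht0.trans hx.1)
    (fun s hs => (hderiv s (ht0.trans hs.1.le)).mono (Ioi_subset_Ici (ht0.trans hs.1.le)))
    ((hwint.const_mul _).add (hfint.const_mul C))
    (fun s hs => hineq s (ht0.trans hs.1.le))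
  rw [intervalIntegral.integral_add
      (((intervalIntegrable_iff_integrableOn_Icc_of_le hb).2 hwint).const_mul _)
      (((intervalIntegrable_iff_integrableOn_Icc_of_le hb).2 hfint).const_mul C),
    intervalIntegral.integral_const_mul, intervalIntegral.integral_const_mul] at key
  have hle := mul_le_mul_of_nonneg_left ((intervalIntegral_le_integral_Ici hb (hInt t ht0)
    (fun s hs => hf0 s (ht0.trans hs))).trans (htail t ht0)) hC
  linarith [hz_nonneg b (ht0.trans hb)]
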